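/- Let 𝒩 be a qubit channel given by Kraus operators K_a ∈ M₂(ℂ) (a ranging over a finite type) with Σ_a K_aᴴK_a = 1, so 𝒩(ρ) = Σ_a K_a ρ K_aᴴ, and let Φₙ be its n-fold product channel. Let ψ₁,…,ψ_k ∈ ℂ² be unit vectors, let x₁,…,x_k > 0 with Σᵢ xᵢ = 1, set σ_{ij} = 𝒩(ψᵢψⱼᴴ), and assume each σ_{ii} is positive definite. Let ρ₍ₙ₎ be the matrix indexed by strings s,t : Fin n → Fin 2 with ρ₍ₙ₎(s,t) = Σᵢ xᵢ ∏_{l<n} ψᵢ(s l)·conj(ψᵢ(t l)) (i.e. ρ₍ₙ₎ = Σᵢ xᵢ (ψᵢψᵢᴴ)^{⊗n}), and let M be the matrix indexed by Fin k × (Fin n → Fin 2) with M((i,s),(j,t)) = √(xᵢxⱼ)·Φₙ(Ψ_{ij})(s,t), where Ψ_{ij}(s,t) = ∏_{l<n} ψᵢ(s l)·conj(ψⱼ(t l)). For 0 ≤ r ≤ ⌊n/2⌋ set q_r(σ) = (det σ)^r • S_{n−2r}(σ), m_r = C(n,r) − C(n,r−1) (with C(n,−1) = 0), q̄_r = Σᵢ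 xᵢ·tr q_r(σ_{ii}), c_r = q̄_r·m_r, σ_r = q̄_r⁻¹·Σᵢ xᵢ q_r(σ_{ii}), and let ω_r be the k·(n−2r+1)-dimensional block matrix whose (i,j) block is √(xᵢxⱼ)·q̄_r⁻¹·q_r(σ_{ij}). Then the matrices Φₙ(ρ₍ₙ₎), M, σ_r, ω_r are all Hermitian and S(Φₙ(ρ₍ₙ₎)) − S(M) = Σ_{r=0}^{⌊n/2⌋} c_r·(S(σ_r) − S(ω_r)). -/

import Mathlib

open Matrix BigOperators
open scoped ComplexOrder

noncomputable section

/-- Matrix of the Kraus operator `K_u` acting on `n` systems. -/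
def krausAt {ι : Type*} {d n : ℕ} (K : ι → Matrix (Fin d) (Fin d) ℂ) (u : Fin n → ι) :
    Matrix (Fin n → Fin d) (Fin n → Fin d) ℂ :=
  Matrix.of fun s t => ∏ i, K (u i) (s i) (t i)

/-- The n-fold product (i.i.d.) channel of the Kraus operators `K`. -/
def prodChannel {ι : Type*} [Fintype ι] {d : ℕ} (K : ι → Matrix (Fin d) (Fin d) ℂ) (n : ℕ)
    (ρ : Matrix (Fin n → Fin d) (Fin n → Fin d) ℂ) :
    Matrix (Fin n → Fin d) (Fin n → Fin d) ℂ :=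
  ∑ u : Fin n → ι, krausAt K u * ρ * (krausAt K u)ᴴ

/-- The matrix `S_m(A)` of the `m`-th symmetric power representation of `GL(2)`. -/
def Sm (m : ℕ) (A : Matrix (Fin 2) (Fin 2) ℂ) :
    Matrix (Fin (m + 1)) (Fin (m + 1)) ℂ :=
  Matrix.of fun k j =>
    (Real.sqrt ((Nat.factorial (k : ℕ) * Nat.factorial (m - (k : ℕ)) : ℝ) /
        (Nat.factorial (j : ℕ) * Nat.factorial (m - (j : ℕ)))) : ℂ) *
    ∑ p ∈ Finset.Icc ((k : ℕ) - (m - (j : ℕ))) (min (k : ℕ) (j : ℕ)),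
      (Nat.choose (j : ℕ) p : ℂ) * (Nat.choose (m - (j : ℕ)) ((k : ℕ) - p) : ℂ) *
        A 0 0 ^ p * A 1 0 ^ ((j : ℕ) - p) * A 0 1 ^ ((k : ℕ) - p) *
        A 1 1 ^ ((m - (j : ℕ)) - ((k : ℕ) - p))

/-- `q_r(A) = (det A)^r • S_{n-2r}(A)`. -/
def qRep (n r : ℕ) (A : Matrix (Fin 2) (Fin 2) ℂ) :
    Matrix (Fin (n - 2 * r + 1)) (Fin (n - 2 * r + 1)) ℂ :=
  A.det ^ r • Sm (n - 2 * r) A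

/-- Multiplicity `m_r = C(n,r) - C(n,r-1)` (with `C(n,-1) = 0`). -/
def mult (n r : ℕ) : ℕ := n.choose r - if r = 0 then 0 else n.choose (r - 1)

/-- Base-2 von Neumann entropy of a (Hermitian) matrix; junk value `0` otherwise. -/
def vnEntropy {m : Type*} [Fintype m] [DecidableEq m] (ρ : Matrix m m ℂ) : ℝ := by
  classical exact
    if h : ρ.IsHermitian then (1 / Real.log 2) * ∑ i, Real.negMulLog (h.eigenvalues i) else 0

/-- Sum of `negMulLog` over the (real parts of the) roots of the characteristic polynomial. -/
def FF {m : Type*} [Fintype m] [DecidableEq m] (N : Matrix m m ℂ) : ℝ :=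
  (N.charpoly.roots.map (fun z => Real.negMulLog z.re)).sum

lemma FF_reindex {m m' : Type*} [Fintype m] [DecidableEq m] [Fintype m'] [DecidableEq m']
    (e : m ≃ m') (N : Matrix m m ℂ) : FF (Matrix.reindex e e N) = FF N := by
  unfold FF; rw [Matrix.charpoly_reindex]

lemma FF_blocks {m m' : Type*} [Fintype m] [DecidableEq m] [Fintype m'] [DecidableEq m']
    (A : Matrix m m ℂ) (B : Matrix m m' ℂ) (D : Matrix m' m' ℂ) :
    FF (Matrix.fromBlocks A B 0 D) = FF A + FF D := by
  unfold FF
  rw [Matrix.charpoly_fromBlocks_zero₂₁, Polynomial.roots_mul, Multiset.map_add, Multiset.sum_add]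
  exact mul_ne_zero (Matrix.charpoly_monic _).ne_zero (Matrix.charpoly_monic _).ne_zero

lemma charpoly_conj_rect {m m' : Type*} [Fintype m] [DecidableEq m] [Fintype m'] [DecidableEq m']
    (P : Matrix m m' ℂ) (Q : Matrix m' m ℂ) (hPQ : P * Q = 1)
    (hc : Fintype.card m = Fintype.card m') (N : Matrix m m ℂ) :
    (Q * N * P).charpoly = N.charpoly := by
  have h := Matrix.charpoly_mul_comm' (Q * N) P
  rw [hc] at h
  have h2 := mul_left_cancel₀ (pow_ne_zero _ Polynomial.X_ne_zero) h
  rw [h2, ← Matrix.mul_assoc, hPQ, Matrix.one_mul]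

lemma FF_conj {m m' : Type*} [Fintype m] [DecidableEq m] [Fintype m'] [DecidableEq m']
    (P : Matrix m m' ℂ) (Q : Matrix m' m ℂ) (hPQ : P * Q = 1)
    (hc : Fintype.card m = Fintype.card m') (N : Matrix m m ℂ) :
    FF (Q * N * P) = FF N := by
  unfold FF; rw [charpoly_conj_rect P Q hPQ hc]

/-- Additivity on (split as vector spaces) short exact sequences, with traces. -/
lemma FF_exact {a b c : Type*} [Fintype a] [DecidableEq a] [Fintype b] [DecidableEq b]
    [Fintype c] [DecidableEq c]
    (ι : Matrix b a ℂ) (s : Matrix b c ℂ) (p : Matrix a b ℂ) (μ : Matrix c b ℂ)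
    (h1 : p * ι = 1) (h2 : μ * s = 1) (h3 : μ * ι = 0) (h4 : p * s = 0)
    (hc : Fintype.card b = Fintype.card a + Fintype.card c)
    (N : Matrix b b ℂ) (N1 : Matrix a a ℂ) (N2 : Matrix c c ℂ)
    (e1 : N * ι = ι * N1) (e2 : μ * N = N2 * μ) :
    FF N = FF N1 + FF N2 ∧ N.trace = N1.trace + N2.trace := by
  have hQP : Matrix.fromRows p μ * Matrix.fromCols ι s = 1 := by
    rw [Matrix.fromRows_mul_fromCols, h1, h2, h3, h4, Matrix.fromBlocks_one]
  have hcard : Fintype.card b = Fintype.card (a ⊕ c) := by simpa using hc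
  have hPQ : Matrix.fromCols ι s * Matrix.fromRows p μ = 1 :=
    (Matrix.mul_eq_one_comm_of_equiv (Fintype.card_eq.mp hcard.symm).some).mp hQP
  have key : Matrix.fromRows p μ * N * Matrix.fromCols ι s
      = Matrix.fromBlocks N1 (p * N * s) 0 N2 := by
    rw [Matrix.fromRows_mul, Matrix.fromRows_mul_fromCols]
    congr 1
    · rw [Matrix.mul_assoc, e1, ← Matrix.mul_assoc, h1, Matrix.one_mul]
    · rw [e2, Matrix.mul_assoc, h3, Matrix.mul_zero]
    · rw [e2, Matrix.mul_assoc, h2, Matrix.mul_one]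
  constructor
  · rw [← FF_conj _ _ hPQ hcard N, key, FF_blocks]
  · have : (Matrix.fromRows p μ * N * Matrix.fromCols ι s).trace = N.trace := by
      rw [Matrix.trace_mul_comm, ← Matrix.mul_assoc, hPQ, Matrix.one_mul]
    rw [← this, key]
    simp [Matrix.trace, Fintype.sum_sum_type]

lemma FF_herm {m : Type*} [Fintype m] [DecidableEq m] (N : Matrix m m ℂ) (h : N.IsHermitian)
    (c : ℝ) : FF ((c : ℂ) • N) = c * FF N + Real.negMulLog c * N.trace.re := by
  have hd : ∀ c : ℝ, FF ((c : ℂ) • N) = ∑ i, Real.negMulLog (c * h.eigenvalues i) := by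
    intro c
    have hs := h.spectral_theorem
    rw [Unitary.conjStarAlgAut_apply] at hs
    have e : (c : ℂ) • N = (h.eigenvectorUnitary : Matrix m m ℂ) *
        Matrix.diagonal (fun i => ((c * h.eigenvalues i : ℝ) : ℂ)) *
        star (h.eigenvectorUnitary : Matrix m m ℂ) := by
      conv_lhs => rw [hs]
      rw [← Matrix.smul_mul, ← Matrix.mul_smul]
      congr 2
      ext i j
      by_cases hij : i = j
      · subst hij; simp
      · simp [hij]
    rw [e, FF_conj _ _ (Unitary.coe_star_mul_self _) rfl]
    unfold FF
    rw [Matrix.charpoly_diagonal, Polynomial.roots_prod]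
    · simp only [Polynomial.roots_X_sub_C, Multiset.bind_singleton, Multiset.map_map,
        Function.comp_def, Complex.ofReal_re]
      rfl
    · exact Finset.prod_ne_zero_iff.mpr fun i _ => Polynomial.X_sub_C_ne_zero _
  have h1 : FF N = ∑ i, Real.negMulLog (h.eigenvalues i) := by simpa using hd 1
  rw [hd, h1, h.trace_eq_sum_eigenvalues]
  simp only [Real.negMulLog_mul, Finset.sum_add_distrib, Finset.mul_sum]
  simp [Finset.mul_sum, add_comm, mul_comm]

lemma vnEntropy_eq {m : Type*} [Fintype m] [DecidableEq m] (N : Matrix m m ℂ)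
    (h : N.IsHermitian) : vnEntropy N = (1 / Real.log 2) * FF N := by
  unfold vnEntropy FF
  rw [dif_pos h, h.roots_charpoly_eq_eigenvalues]
  simp

/-- `Σ_l C_l ⊗ R_l`. -/
def TT {Λ κ α : Type*} [Fintype Λ] (C : Λ → Matrix κ κ ℂ) (R : Λ → Matrix α α ℂ) :
    Matrix (κ × α) (κ × α) ℂ := ∑ l, Matrix.kronecker (C l) (R l)

lemma TT_reindex {Λ κ α β : Type*} [Fintype Λ] [Fintype κ] [DecidableEq κ] [Fintype α]
    [DecidableEq α] [Fintype β] [DecidableEq β] (C : Λ → Matrix κ κ ℂ) (R : Λ → Matrix α α ℂ)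
    (e : α ≃ β) : FF (TT C (fun l => Matrix.reindex e e (R l))) = FF (TT C R) := by
  rw [← FF_reindex (Equiv.prodCongr (Equiv.refl κ) e) (TT C R)]
  congr 1
  ext ⟨i, s⟩ ⟨j, t⟩
  simp [TT, Matrix.sum_apply]

lemma TT_assoc {Λ κ α β : Type*} [Fintype Λ] [Fintype κ] [DecidableEq κ] [Fintype α]
    [DecidableEq α] [Fintype β] [DecidableEq β] (C : Λ → Matrix κ κ ℂ) (A : Λ → Matrix α α ℂ)
    (R : Λ → Matrix β β ℂ) :
    FF (TT (fun l => Matrix.kronecker (C l) (A l)) R)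
      = FF (TT C (fun l => Matrix.kronecker (A l) (R l))) := by
  rw [← FF_reindex (Equiv.prodAssoc κ α β)]
  congr 1
  ext ⟨i, s, t⟩ ⟨j, s', t'⟩
  simp [TT, Matrix.sum_apply, mul_assoc]

lemma TT_exact {Λ κ a b c : Type*} [Fintype Λ] [Fintype κ] [DecidableEq κ] [Fintype a]
    [DecidableEq a] [Fintype b] [DecidableEq b] [Fintype c] [DecidableEq c]
    (ι : Matrix b a ℂ) (s : Matrix b c ℂ) (p : Matrix a b ℂ) (μ : Matrix c b ℂ)
    (h1 : p * ι = 1) (h2 : μ * s = 1) (h3 : μ * ι = 0) (h4 : p * s = 0)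
    (hc : Fintype.card b = Fintype.card a + Fintype.card c)
    (C : Λ → Matrix κ κ ℂ)
    (N : Λ → Matrix b b ℂ) (N1 : Λ → Matrix a a ℂ) (N2 : Λ → Matrix c c ℂ)
    (e1 : ∀ l, N l * ι = ι * N1 l) (e2 : ∀ l, μ * N l = N2 l * μ) :
    FF (TT C N) = FF (TT C N1) + FF (TT C N2) := by
  refine (FF_exact (Matrix.kronecker (1 : Matrix κ κ ℂ) ι) (Matrix.kronecker (1 : Matrix κ κ ℂ) s)
    (Matrix.kronecker (1 : Matrix κ κ ℂ) p) (Matrix.kronecker (1 : Matrix κ κ ℂ) μ)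
    ?_ ?_ ?_ ?_ ?_ _ _ _ ?_ ?_).1
  · simp [Matrix.kronecker, ← Matrix.mul_kronecker_mul, h1]
  · simp [Matrix.kronecker, ← Matrix.mul_kronecker_mul, h2]
  · simp [Matrix.kronecker, ← Matrix.mul_kronecker_mul, h3]
  · simp [Matrix.kronecker, ← Matrix.mul_kronecker_mul, h4]
  · simp [hc, mul_add]
  · simp [TT, Matrix.kronecker, Matrix.sum_mul, Matrix.mul_sum, ← Matrix.mul_kronecker_mul, e1]
  · simp [TT, Matrix.kronecker, Matrix.sum_mul, Matrix.mul_sum, ← Matrix.mul_kronecker_mul, e2]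

lemma TT_conj {Λ κ a : Type*} [Fintype Λ] [Fintype κ] [DecidableEq κ] [Fintype a]
    [DecidableEq a] (P Q : Matrix a a ℂ) (h : P * Q = 1) (C : Λ → Matrix κ κ ℂ)
    (N : Λ → Matrix a a ℂ) : FF (TT C (fun l => Q * N l * P)) = FF (TT C N) := by
  rw [← FF_conj (Matrix.kronecker (1 : Matrix κ κ ℂ) P) (Matrix.kronecker (1 : Matrix κ κ ℂ) Q)
    (by simp [Matrix.kronecker, ← Matrix.mul_kronecker_mul, h]) rfl (TT C N)]
  congr 1
  simp [TT, Matrix.kronecker, Matrix.sum_mul, Matrix.mul_sum, ← Matrix.mul_kronecker_mul]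

/-- The image of the monomial `X^j` (in degree `N-1`). -/
def monoIm (A : Matrix (Fin 2) (Fin 2) ℂ) (j l : ℕ) : Polynomial ℂ :=
  (Polynomial.C (A 0 0) * Polynomial.X + Polynomial.C (A 1 0)) ^ j *
    (Polynomial.C (A 0 1) * Polynomial.X + Polynomial.C (A 1 1)) ^ l

lemma monoIm_natDegree (A : Matrix (Fin 2) (Fin 2) ℂ) (j l : ℕ) :
    (monoIm A j l).natDegree ≤ j + l := by
  unfold monoIm
  refine (Polynomial.natDegree_mul_le).trans (add_le_add ?_ ?_)
  · refine (Polynomial.natDegree_pow_le).trans ?_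
    have := Polynomial.natDegree_linear_le (a := A 0 0) (b := A 1 0)
    nlinarith
  · refine (Polynomial.natDegree_pow_le).trans ?_
    have := Polynomial.natDegree_linear_le (a := A 0 1) (b := A 1 1)
    nlinarith

/-- The symmetric power in the monomial basis, of dimension `N`. -/
def UU (N : ℕ) (A : Matrix (Fin 2) (Fin 2) ℂ) : Matrix (Fin N) (Fin N) ℂ :=
  Matrix.of fun k j => (monoIm A j (N - 1 - j)).coeff k

def cgI (N : ℕ) : Matrix (Fin 2 × Fin (N + 1)) (Fin N) ℂ :=
  Matrix.of fun a j => if a.1 = 0 then (if a.2 = j.castSucc then 1 else 0)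
    else -(if a.2 = j.succ then 1 else 0)

def cgM (N : ℕ) : Matrix (Fin (N + 2)) (Fin 2 × Fin (N + 1)) ℂ :=
  Matrix.of fun k a => if a.1 = 0 then (if k = a.2.succ then 1 else 0)
    else (if k = a.2.castSucc then 1 else 0)

def cgS (N : ℕ) : Matrix (Fin 2 × Fin (N + 1)) (Fin (N + 2)) ℂ :=
  Matrix.of fun a k => if a.1 = 0 then (if k = a.2.succ then 1 else 0)
    else (if a.2 = 0 then (if k = 0 then 1 else 0) else 0)

def cgP (N : ℕ) : Matrix (Fin N) (Fin 2 × Fin (N + 1)) ℂ :=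
  Matrix.of fun j a => if a.1 = 0 then 0 else -(if a.2 = j.succ then 1 else 0)

lemma cg1 (N : ℕ) : cgP N * cgI N = 1 := by
  ext j j'
  simp [cgP, cgI, Matrix.mul_apply, Fintype.sum_prod_type, Matrix.one_apply, eq_comm]

lemma cg2 (N : ℕ) : cgM N * cgS N = 1 := by
  ext k k'
  refine Fin.cases ?_ (fun k => ?_) k
  · simp [cgM, cgS, Matrix.mul_apply, Fintype.sum_prod_type, Matrix.one_apply, eq_comm]
  · simp [cgM, cgS, Matrix.mul_apply, Fintype.sum_prod_type, Matrix.one_apply]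
    rw [Finset.sum_eq_single k]
    · simp [eq_comm]
    · intro b _ hb
      simp [hb.symm]
    · simp

lemma cg3 (N : ℕ) : cgM N * cgI N = 0 := by
  ext k j
  simp [cgM, cgI, Matrix.mul_apply, Fintype.sum_prod_type]

lemma cg4 (N : ℕ) : cgP N * cgS N = 0 := by
  ext j k
  simp [cgP, cgS, Matrix.mul_apply, Fintype.sum_prod_type, (Fin.succ_ne_zero _).symm]

lemma cgI_mul (N : ℕ) (B : Matrix (Fin N) (Fin N) ℂ) (a : Fin (N+1)) (j : Fin N)
    (p : Polynomial ℂ) (hp : p.coeff N = 0) (hB : ∀ k : Fin N, B k j = p.coeff k) :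
    (cgI N * B) (0, a) j = p.coeff a ∧ (cgI N * B) (1, a) j = -(Polynomial.X * p).coeff a := by
  constructor
  · simp only [cgI, Matrix.mul_apply, hB]
    refine Fin.lastCases ?_ (fun k => ?_) a
    · simp [hp, (Fin.castSucc_lt_last _).ne']
    · simp
  · simp only [cgI, Matrix.mul_apply, hB]
    refine Fin.cases ?_ (fun k => ?_) a
    · simp [(Fin.succ_ne_zero _).symm]
    · simp

lemma cgM_mul (N : ℕ) (B : Matrix (Fin 2 × Fin (N + 1)) (Fin 2 × Fin (N + 1)) ℂ)
    (k : Fin (N + 2)) (b : Fin 2 × Fin (N + 1)) (p q : Polynomial ℂ)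
    (hq : q.coeff (N + 1) = 0) (hB : ∀ k : Fin (N + 1), B (0, k) b = p.coeff k)
    (hB' : ∀ k : Fin (N + 1), B (1, k) b = q.coeff k) :
    (cgM N * B) k b = (Polynomial.X * p + q).coeff k := by
  simp only [cgM, Matrix.mul_apply, Fintype.sum_prod_type, Fin.sum_univ_two, hB, hB',
    Polynomial.coeff_add]
  simp only [Matrix.of_apply, if_true, one_ne_zero, if_false]
  congr 1
  · refine Fin.cases ?_ (fun k => ?_) k
    · simp [(Fin.succ_ne_zero _).symm]
    · simp
  · refine Fin.lastCases ?_ (fun k => ?_) k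
    · simp [hq, (Fin.castSucc_lt_last _).ne']
    · simp

lemma cg_e1 (N : ℕ) (A : Matrix (Fin 2) (Fin 2) ℂ) :
    Matrix.kronecker A (UU (N + 1) A) * cgI N = cgI N * (A.det • UU N A) := by
  ext ⟨c, a⟩ j
  have hj := j.2
  have h := cgI_mul N (A.det • UU N A) a j (Polynomial.C A.det * monoIm A j (N - 1 - j)) (by
    rw [Polynomial.coeff_C_mul, Polynomial.coeff_eq_zero_of_natDegree_lt, mul_zero]
    exact (monoIm_natDegree _ _ _).trans_lt (by omega)) (by
      intro k; simp [UU])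
  have e1 : N + 1 - 1 - (j : ℕ) = (N - 1 - j) + 1 := by omega
  have e2 : N - ((j : ℕ) + 1) = (N - 1 - j) := by omega
  have hL : ∀ c, (Matrix.kronecker A (UU (N + 1) A) * cgI N) (c, a) j =
      (Polynomial.C (A c 0) * monoIm A j ((N - 1 - j) + 1)
        - Polynomial.C (A c 1) * monoIm A (j + 1) (N - 1 - j)).coeff a := by
    intro c
    rw [Matrix.mul_apply, Fintype.sum_prod_type, Fin.sum_univ_two]
    simp [cgI, UU, e2, ← e1, sub_eq_add_neg]
  rw [hL]
  revert c
  rw [Fin.forall_fin_two]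
  rw [h.1, h.2]
  constructor
  · congr 1
    simp only [monoIm, Matrix.det_fin_two, Polynomial.C_sub, Polynomial.C_mul]
    ring
  · rw [← Polynomial.coeff_neg]
    congr 1
    simp only [monoIm, Matrix.det_fin_two, Polynomial.C_sub, Polynomial.C_mul]
    ring

lemma cg_e2 (N : ℕ) (A : Matrix (Fin 2) (Fin 2) ℂ) :
    cgM N * Matrix.kronecker A (UU (N + 1) A) = UU (N + 2) A * cgM N := by
  ext k ⟨c, j⟩
  have hj := j.2
  rw [cgM_mul N _ k (c, j) (Polynomial.C (A 0 c) * monoIm A j (N - j))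
    (Polynomial.C (A 1 c) * monoIm A j (N - j)) (by
    rw [Polynomial.coeff_C_mul, Polynomial.coeff_eq_zero_of_natDegree_lt, mul_zero]
    exact (monoIm_natDegree _ _ _).trans_lt (by omega)) (by intro k; simp [UU])
    (by intro k; simp [UU])]
  have e1 : N + 1 - (j : ℕ) = (N - j) + 1 := by omega
  have hR : ∀ c, (UU (N + 2) A * cgM N) k (c, j) = if c = 0 then (monoIm A (j + 1) (N - j)).coeff k
      else (monoIm A j (N - j + 1)).coeff k := by
    intro c
    rw [Matrix.mul_apply]
    split_ifs with hc
    · simp [cgM, UU, hc]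
    · simp [cgM, UU, hc, e1]
  rw [hR]
  revert c
  rw [Fin.forall_fin_two]
  constructor
  · simp only [if_true]
    congr 1
    simp only [monoIm]
    ring
  · simp only [one_ne_zero, if_false]
    congr 1
    simp only [monoIm]
    ring

/-- Clebsch-Gordan. -/
lemma TT_cg {Λ κ : Type*} [Fintype Λ] [Fintype κ] [DecidableEq κ] (C : Λ → Matrix κ κ ℂ)
    (A : Λ → Matrix (Fin 2) (Fin 2) ℂ) (r N : ℕ) :
    FF (TT C fun l => Matrix.kronecker (A l) ((A l).det ^ r • UU (N + 1) (A l))) =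
      FF (TT C fun l => (A l).det ^ (r + 1) • UU N (A l)) +
      FF (TT C fun l => (A l).det ^ r • UU (N + 2) (A l)) := by
  refine TT_exact (cgI N) (cgS N) (cgP N) (cgM N) (cg1 N) (cg2 N) (cg3 N) (cg4 N) ?_ _ _ _ _ ?_ ?_
  · simp; ring
  · intro l
    have : Matrix.kronecker (A l) ((A l).det ^ r • UU (N + 1) (A l)) =
        (A l).det ^ r • Matrix.kronecker (A l) (UU (N + 1) (A l)) := by
      simp [Matrix.kronecker, Matrix.kronecker_smul]
    rw [this, Matrix.smul_mul, cg_e1, pow_succ, mul_smul, Matrix.mul_smul, Matrix.mul_smul,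
      Matrix.mul_smul]
  · intro l
    have : Matrix.kronecker (A l) ((A l).det ^ r • UU (N + 1) (A l)) =
        (A l).det ^ r • Matrix.kronecker (A l) (UU (N + 1) (A l)) := by
      simp [Matrix.kronecker, Matrix.kronecker_smul]
    rw [this, Matrix.mul_smul, cg_e2, Matrix.smul_mul]

lemma trace_cg (A : Matrix (Fin 2) (Fin 2) ℂ) (N : ℕ) :
    A.trace * (UU (N + 1) A).trace = A.det * (UU N A).trace + (UU (N + 2) A).trace := by
  have := (FF_exact (cgI N) (cgS N) (cgP N) (cgM N) (cg1 N) (cg2 N) (cg3 N) (cg4 N)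
    (by simp; ring) _ _ _ (cg_e1 N A) (cg_e2 N A)).2
  simpa [Matrix.kronecker, Matrix.trace_kronecker] using this

/-- weights -/
def wt (m k : ℕ) : ℝ := (Nat.factorial k * Nat.factorial (m - k) : ℝ)

lemma wt_pos (m k : ℕ) : 0 < wt m k := by unfold wt; positivity

lemma coeff_lin_pow (a c : ℂ) (j p : ℕ) :
    ((Polynomial.C a * Polynomial.X + Polynomial.C c) ^ j).coeff p
      = (j.choose p : ℂ) * a ^ p * c ^ (j - p) := by
  rw [add_pow]
  simp only [mul_pow, ← Polynomial.C_pow, Polynomial.finsetSum_coeff]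
  have : ∀ x, ((Polynomial.C (a ^ x) * Polynomial.X ^ x * Polynomial.C (c ^ (j - x)) *
      ((j.choose x : ℕ) : Polynomial ℂ)).coeff p) =
      if x = p then (j.choose p : ℂ) * a ^ p * c ^ (j - p) else 0 := by
    intro x
    rw [show Polynomial.C (a ^ x) * Polynomial.X ^ x * Polynomial.C (c ^ (j - x)) *
      ((j.choose x : ℕ) : Polynomial ℂ) =
      Polynomial.C ((j.choose x : ℂ) * a ^ x * c ^ (j - x)) * Polynomial.X ^ x by
        simp only [Polynomial.C_mul, Polynomial.C_pow, map_natCast]; ring]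
    rw [Polynomial.coeff_C_mul, Polynomial.coeff_X_pow]
    split_ifs with h1 h2 h2
    · subst h1; simp
    · exact absurd h1.symm h2
    · exact absurd h2.symm h1
    · simp
  simp only [this]
  rw [Finset.sum_ite_eq']
  split_ifs with h
  · rfl
  · rw [Nat.choose_eq_zero_of_lt (by simpa using h)]; simp

lemma monoIm_coeff (A : Matrix (Fin 2) (Fin 2) ℂ) (m j k : ℕ) (hj : j ≤ m) :
    (monoIm A j (m - j)).coeff k =
    ∑ p ∈ Finset.Icc (k - (m - j)) (min k j),
      (Nat.choose j p : ℂ) * (Nat.choose (m - j) (k - p) : ℂ) *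
        A 0 0 ^ p * A 1 0 ^ (j - p) * A 0 1 ^ (k - p) * A 1 1 ^ ((m - j) - (k - p)) := by
  unfold monoIm
  rw [Polynomial.coeff_mul, Finset.Nat.sum_antidiagonal_eq_sum_range_succ_mk]
  simp only [coeff_lin_pow]
  symm
  have hsub : Finset.Icc (k - (m - j)) (min k j) ⊆ Finset.range (k + 1) := by
    intro p; simp; omega
  rw [← Finset.sum_subset hsub]
  · refine Finset.sum_congr rfl fun p _ => by ring
  · intro p hp hp'
    simp only [Finset.mem_range, Finset.mem_Icc, le_min_iff, not_and_or, not_le] at hp hp'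
    rcases hp' with h | h | h
    · rw [Nat.choose_eq_zero_of_lt (show m - j < k - p by omega)]; simp
    · omega
    · rw [Nat.choose_eq_zero_of_lt h]; simp

lemma Sm_eq (m : ℕ) (A : Matrix (Fin 2) (Fin 2) ℂ) :
    Sm m A = Matrix.diagonal (fun k : Fin (m + 1) => (Real.sqrt (wt m k) : ℂ)) * UU (m + 1) A *
      Matrix.diagonal (fun k : Fin (m + 1) => ((Real.sqrt (wt m k))⁻¹ : ℂ)) := by
  ext k j
  have hj := j.2
  rw [Matrix.mul_diagonal, Matrix.diagonal_mul]
  simp only [Sm, UU, Matrix.of_apply, Nat.add_sub_cancel]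
  rw [monoIm_coeff A m j k (by omega)]
  change ((Real.sqrt (wt m k / wt m j) : ℝ) : ℂ) * _ = _
  rw [Real.sqrt_div (wt_pos _ _).le]
  push_cast
  ring

lemma wt_diag (m : ℕ) : Matrix.diagonal (fun k : Fin (m + 1) => ((Real.sqrt (wt m k))⁻¹ : ℂ)) *
    Matrix.diagonal (fun k : Fin (m + 1) => (Real.sqrt (wt m k) : ℂ)) = 1 := by
  rw [Matrix.diagonal_mul_diagonal, ← Matrix.diagonal_one]
  congr 1
  ext k
  have := (Real.sqrt_pos.mpr (wt_pos m k)).ne'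
  field_simp

lemma TT_qRep {Λ κ : Type*} [Fintype Λ] [Fintype κ] [DecidableEq κ] (C : Λ → Matrix κ κ ℂ)
    (A : Λ → Matrix (Fin 2) (Fin 2) ℂ) (n r : ℕ) :
    FF (TT C fun l => qRep n r (A l)) =
      FF (TT C fun l => (A l).det ^ r • UU (n - 2 * r + 1) (A l)) := by
  rw [← TT_conj _ _ (wt_diag (n - 2 * r)) C
    (fun l => (A l).det ^ r • UU (n - 2 * r + 1) (A l))]
  congr 1
  congr 1
  ext1 l
  rw [qRep, Sm_eq, Matrix.mul_smul, Matrix.smul_mul]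

lemma trace_Sm (m : ℕ) (A : Matrix (Fin 2) (Fin 2) ℂ) : (Sm m A).trace = (UU (m + 1) A).trace := by
  rw [Sm_eq, Matrix.trace_mul_comm, ← Matrix.mul_assoc, wt_diag, Matrix.one_mul]

lemma trace_UU_pos (A : Matrix (Fin 2) (Fin 2) ℂ) (a b : ℝ) (ha : 0 < a) (hb : 0 < b)
    (htr : A.trace = (a + b : ℝ)) (hdet : A.det = (a * b : ℝ)) (N : ℕ) :
    ∃ t t' : ℝ, 0 ≤ t ∧ 0 < t' ∧ (UU N A).trace = t ∧ (UU (N + 1) A).trace = t' ∧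
      t' = a * t + b ^ N := by
  induction N with
  | zero =>
    refine ⟨0, 1, le_rfl, one_pos, by simp [Matrix.trace], ?_, by simp⟩
    simp [Matrix.trace, UU, monoIm]
  | succ N ih =>
    obtain ⟨t, t', h0, h1, e, e', r⟩ := ih
    have h := trace_cg A N
    rw [e, e', htr, hdet] at h
    refine ⟨t', a * t' + b ^ (N + 1), h1.le, by positivity, e', ?_, rfl⟩
    have : (UU (N + 2) A).trace = ((a + b : ℝ) : ℂ) * t' - ((a * b : ℝ) : ℂ) * t := by
      rw [h]; ring
    rw [this]
    norm_cast
    rw [r]; ring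

lemma trace_qRep_pos (A : Matrix (Fin 2) (Fin 2) ℂ) (hA : A.PosDef) (n r : ℕ) :
    ∃ t : ℝ, 0 < t ∧ (qRep n r A).trace = t := by
  have h := hA.isHermitian
  have hp := hA.eigenvalues_pos
  have htr : A.trace = (h.eigenvalues 0 + h.eigenvalues 1 : ℝ) := by
    rw [h.trace_eq_sum_eigenvalues, Fin.sum_univ_two]; push_cast; rfl
  have hdet : A.det = (h.eigenvalues 0 * h.eigenvalues 1 : ℝ) := by
    rw [h.det_eq_prod_eigenvalues, Fin.prod_univ_two]; push_cast; rfl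
  obtain ⟨t, t', _, ht', _, e, _⟩ := trace_UU_pos A _ _ (hp 0) (hp 1) htr hdet (n - 2 * r)
  refine ⟨(h.eigenvalues 0 * h.eigenvalues 1) ^ r * t', ?_, ?_⟩
  · have := hp 0; have := hp 1; positivity
  · rw [qRep, Matrix.trace_smul, trace_Sm, e, hdet]; simp

lemma choose_wt (m k j p : ℕ) (hk : k ≤ m) (hj : j ≤ m) (h1 : p ≤ k) (h2 : p ≤ j)
    (h3 : k + j ≤ m + p) :
    wt m j * ((k.choose p : ℝ) * ((m - k).choose (j - p))) =
      wt m k * ((j.choose p : ℝ) * ((m - j).choose (k - p))) := by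
  unfold wt
  have a1 := Nat.choose_mul_factorial_mul_factorial h1
  have a2 := Nat.choose_mul_factorial_mul_factorial h2
  have a3 := Nat.choose_mul_factorial_mul_factorial (show j - p ≤ m - k by omega)
  have a4 := Nat.choose_mul_factorial_mul_factorial (show k - p ≤ m - j by omega)
  rw [show m - k - (j - p) = m + p - k - j by omega] at a3
  rw [show m - j - (k - p) = m + p - k - j by omega] at a4
  rw [← a1, ← a2, ← a3, ← a4]
  push_cast
  ring

lemma Sm_conjTranspose (m : ℕ) (A : Matrix (Fin 2) (Fin 2) ℂ) : (Sm m A)ᴴ = Sm m Aᴴ := by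
  ext k j
  have hj := j.2
  have hk := k.2
  rw [Matrix.conjTranspose_apply]
  simp only [Sm, Matrix.of_apply]
  change star (((Real.sqrt (wt m j / wt m k) : ℝ) : ℂ) * _) =
    ((Real.sqrt (wt m k / wt m j) : ℝ) : ℂ) * _
  have hs : Real.sqrt (wt m j / wt m k) = Real.sqrt (wt m k / wt m j) * (wt m j / wt m k) := by
    have p1 := wt_pos m j
    have p2 := wt_pos m k
    have q1 := (Real.sqrt_pos.mpr p1).ne'
    have q2 := (Real.sqrt_pos.mpr p2).ne'
    rw [Real.sqrt_div p1.le, Real.sqrt_div p2.le]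
    rw [div_mul_div_comm, div_eq_div_iff q2 (mul_ne_zero q1 p2.ne')]
    nlinarith [Real.mul_self_sqrt p1.le, Real.mul_self_sqrt p2.le]
  rw [hs, star_mul']
  rw [show star ((Real.sqrt (wt m k / wt m j) * (wt m j / wt m k) : ℝ) : ℂ) =
    ((Real.sqrt (wt m k / wt m j) : ℝ) : ℂ) * ((wt m j / wt m k : ℝ) : ℂ) by
      rw [← Complex.ofReal_mul]; exact Complex.conj_ofReal _]
  rw [mul_assoc]
  congr 1
  rw [star_sum, Finset.mul_sum, min_comm, show (j : ℕ) - (m - k) = k - (m - j) by omega]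
  refine Finset.sum_congr rfl fun p hp => ?_
  simp only [Finset.mem_Icc, le_min_iff] at hp
  have hw := choose_wt m k j p (by omega) (by omega) (by omega) (by omega) (by omega)
  have hw' : wt m j / wt m k * ((Nat.choose k p : ℝ) * (Nat.choose (m - k) (j - p))) =
      (Nat.choose j p : ℝ) * (Nat.choose (m - j) (k - p)) := by
    have := (wt_pos m k).ne'
    field_simp
    linarith
  have hw2 : ((wt m j / wt m k : ℝ) : ℂ) * ((Nat.choose k p : ℂ) * (Nat.choose (m - k) (j - p))) =
      (Nat.choose j p : ℂ) * (Nat.choose (m - j) (k - p)) := by exact_mod_cast hw'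
  rw [← hw2, show m - (j : ℕ) - (k - p) = m - k - (j - p) by omega]
  simp only [star_mul', star_pow, Matrix.conjTranspose_apply, star_natCast]
  ring

lemma qRep_conjTranspose (n r : ℕ) (A : Matrix (Fin 2) (Fin 2) ℂ) :
    (qRep n r A)ᴴ = qRep n r Aᴴ := by
  rw [qRep, qRep, Matrix.conjTranspose_smul, Sm_conjTranspose, Matrix.det_conjTranspose, star_pow]

/-- Tensor product of a family of matrices. -/
def tens {n : ℕ} (B : Fin n → Matrix (Fin 2) (Fin 2) ℂ) :
    Matrix (Fin n → Fin 2) (Fin n → Fin 2) ℂ := Matrix.of fun s t => ∏ l, B l (s l) (t l)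

lemma tens_mul {n : ℕ} (B B' : Fin n → Matrix (Fin 2) (Fin 2) ℂ) :
    tens B * tens B' = tens (fun l => B l * B' l) := by
  ext s t
  simp only [tens, Matrix.mul_apply, Matrix.of_apply]
  rw [Finset.prod_univ_sum, Fintype.piFinset_univ]
  simp only [Finset.prod_mul_distrib]

lemma tens_conjTranspose {n : ℕ} (B : Fin n → Matrix (Fin 2) (Fin 2) ℂ) :
    (tens B)ᴴ = tens (fun l => (B l)ᴴ) := by
  ext s t
  simp [tens]

lemma tens_sum {n : ℕ} {ι : Type*} [Fintype ι] (B : ι → Matrix (Fin 2) (Fin 2) ℂ) :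
    ∑ u : Fin n → ι, tens (fun l => B (u l)) = tens (fun _ => ∑ a, B a) := by
  classical
  ext s t
  simp only [tens, Matrix.sum_apply, Matrix.of_apply]
  rw [Finset.prod_univ_sum, Fintype.piFinset_univ]

lemma prodChannel_pure {ι : Type*} [Fintype ι] (K : ι → Matrix (Fin 2) (Fin 2) ℂ) (n : ℕ)
    (f g : Fin 2 → ℂ) :
    prodChannel K n (Matrix.of fun s t => ∏ l, f (s l) * starRingEnd ℂ (g (t l))) =
      tens (fun _ : Fin n => ∑ a, K a * Matrix.vecMulVec f (star g) * (K a)ᴴ) := by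
  have h : (Matrix.of fun s t => ∏ l, f (s l) * starRingEnd ℂ (g (t l))) =
      tens (fun _ : Fin n => Matrix.vecMulVec f (star g)) := by
    ext s t
    simp [tens, Matrix.vecMulVec_apply]
  have hk : ∀ u : Fin n → ι, krausAt K u = tens (fun l => K (u l)) := fun u => rfl
  rw [h, prodChannel]
  simp only [hk, tens_conjTranspose, tens_mul]
  exact tens_sum (fun a => K a * Matrix.vecMulVec f (star g) * (K a)ᴴ)

lemma prodChannel_mix {ι : Type*} [Fintype ι] (K : ι → Matrix (Fin 2) (Fin 2) ℂ) (n k : ℕ)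
    (c : Fin k → ℂ) (X : Fin k → Matrix (Fin n → Fin 2) (Fin n → Fin 2) ℂ) :
    prodChannel K n (∑ i, c i • X i) = ∑ i, c i • prodChannel K n (X i) := by
  simp only [prodChannel, Matrix.mul_sum, Matrix.sum_mul, Finset.smul_sum, Matrix.mul_smul,
    Matrix.smul_mul]
  rw [Finset.sum_comm]

lemma tens_succ (n : ℕ) (A : Matrix (Fin 2) (Fin 2) ℂ) :
    tens (fun _ : Fin (n + 1) => A) =
      Matrix.reindex (Fin.consEquiv (fun _ => Fin 2)) (Fin.consEquiv (fun _ => Fin 2))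
        (Matrix.kronecker A (tens (fun _ : Fin n => A))) := by
  ext s t
  simp [tens, Fin.prod_univ_succ, Fin.tail, Fin.consEquiv]

lemma mult_succ_eq (n r : ℕ) (h : 2 * (r + 1) ≤ n + 1) :
    (mult n (r + 1) : ℝ) = (n.choose (r + 1) : ℝ) - n.choose r := by
  have hle : n.choose r ≤ n.choose (r + 1) := by
    rcases Nat.lt_or_ge r (n / 2) with h1 | h1
    · exact Nat.choose_le_succ_of_lt_half_left h1
    · have : n = 2 * r + 1 := by omega
      subst this
      exact (Nat.choose_symm_half r).symm.le
  simp [mult, Nat.cast_sub hle]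

lemma mult_zero (n : ℕ) : mult n 0 = 1 := by simp [mult]

lemma mult_rec (n r : ℕ) (h : 2 * (r + 1) ≤ n + 1) :
    (mult (n + 1) (r + 1) : ℝ) = mult n (r + 1) + mult n r := by
  rw [mult_succ_eq n r h, mult_succ_eq (n + 1) r (by omega)]
  cases r with
  | zero => simp [mult_zero]
  | succ r =>
    rw [mult_succ_eq n r (by omega), Nat.choose_succ_succ n (r + 1), Nat.choose_succ_succ n r]
    push_cast
    ring

lemma mult_sum (n : ℕ) (h : ℕ → ℝ) (h0 : ∀ q, n = 2 * q → h (q + 1) = 0) :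
    ∑ r ∈ Finset.range (n / 2 + 1), (mult n r : ℝ) * (h (r + 1) + h r) =
      ∑ r ∈ Finset.range ((n + 1) / 2 + 1), (mult (n + 1) r : ℝ) * h r := by
  rw [Finset.sum_range_succ' (fun r => (mult (n + 1) r : ℝ) * h r)]
  have hr : ∑ r ∈ Finset.range ((n + 1) / 2), (mult (n + 1) (r + 1) : ℝ) * h (r + 1) =
      ∑ r ∈ Finset.range ((n + 1) / 2), ((mult n (r + 1) : ℝ) * h (r + 1) +
        (mult n r : ℝ) * h (r + 1)) := by
    refine Finset.sum_congr rfl fun r hr => ?_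
    rw [mult_rec n r (by rw [Finset.mem_range] at hr; omega)]; ring
  rw [hr, Finset.sum_add_distrib]
  simp only [mul_add]
  rw [Finset.sum_add_distrib, Finset.sum_range_succ' (fun r => (mult n r : ℝ) * h r)]
  rcases Nat.even_or_odd' n with ⟨q, hq | hq⟩
  · rw [show n / 2 = q by omega, show (n + 1) / 2 = q by omega, Finset.sum_range_succ, h0 q hq]
    simp only [mult_zero]
    ring
  · rw [show n / 2 = q by omega, show (n + 1) / 2 = q + 1 by omega,
      Finset.sum_range_succ (fun r => (mult n (r + 1) : ℝ) * h (r + 1)),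
      mult_succ_eq n q (by omega)]
    have : n.choose (q + 1) = n.choose q := by subst hq; exact Nat.choose_symm_half q
    rw [this]
    simp only [mult_zero]
    ring

lemma FF_isEmpty {m : Type*} [Fintype m] [DecidableEq m] [IsEmpty m] (N : Matrix m m ℂ) :
    FF N = 0 := by
  simp [FF, Matrix.charpoly]

lemma TT_tens (n : ℕ) : ∀ {Λ κ : Type} [Fintype Λ] [Fintype κ] [DecidableEq κ]
    (C : Λ → Matrix κ κ ℂ) (A : Λ → Matrix (Fin 2) (Fin 2) ℂ),
    FF (TT C fun l => tens (fun _ : Fin n => A l)) =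
      ∑ r ∈ Finset.range (n / 2 + 1), (mult n r : ℝ) *
        FF (TT C fun l => (A l).det ^ r • UU (n - 2 * r + 1) (A l)) := by
  induction n with
  | zero =>
    intro Λ κ _ _ _ C A
    rw [← TT_reindex C _ (Equiv.ofUnique (Fin 0 → Fin 2) (Fin 1))]
    simp only [Nat.zero_div, zero_add, Finset.sum_range_one, mult_zero, Nat.cast_one, one_mul]
    congr 2
    ext l i j
    have hi : i = 0 := Subsingleton.elim _ _
    have hj : j = 0 := Subsingleton.elim _ _
    subst hi hj
    simp [tens, UU, monoIm]
  | succ n ih =>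
    intro Λ κ _ _ _ C A
    simp only [tens_succ]
    rw [TT_reindex, ← TT_assoc, ih]
    have hs := mult_sum n (fun r => FF (TT C fun l => (A l).det ^ r • UU (n + 2 - 2 * r) (A l)))
      (by
        intro q hq
        have e : n + 2 - 2 * (q + 1) = 0 := by omega
        rw [e]
        exact FF_isEmpty _)
    have hR : ∀ r ∈ Finset.range ((n + 1) / 2 + 1), (mult (n + 1) r : ℝ) *
        FF (TT C fun l => (A l).det ^ r • UU (n + 1 - 2 * r + 1) (A l)) =
        (mult (n + 1) r : ℝ) * FF (TT C fun l => (A l).det ^ r • UU (n + 2 - 2 * r) (A l)) := by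
      intro r hr
      rw [Finset.mem_range] at hr
      rw [show n + 1 - 2 * r + 1 = n + 2 - 2 * r by omega]
    rw [Finset.sum_congr rfl hR, ← hs]
    refine Finset.sum_congr rfl fun r hr => ?_
    rw [Finset.mem_range] at hr
    rw [TT_assoc, TT_cg]
    rw [show n + 2 - 2 * (r + 1) = n - 2 * r by omega, show n + 2 - 2 * r = n - 2 * r + 2 by omega]

lemma TT_main (n : ℕ) {Λ κ : Type} [Fintype Λ] [Fintype κ] [DecidableEq κ]
    (C : Λ → Matrix κ κ ℂ) (A : Λ → Matrix (Fin 2) (Fin 2) ℂ) :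
    FF (TT C fun l => tens (fun _ : Fin n => A l)) =
      ∑ r ∈ Finset.range (n / 2 + 1), (mult n r : ℝ) * FF (TT C fun l => qRep n r (A l)) := by
  simp only [TT_tens, TT_qRep]

lemma FF_mix {k : ℕ} {α : Type} [Fintype α] [DecidableEq α] (c : Fin k → ℂ)
    (R : Fin k → Matrix α α ℂ) :
    FF (∑ i, c i • R i) = FF (TT (fun i => Matrix.of fun _ _ : Unit => c i) R) := by
  rw [← FF_reindex (Equiv.punitProd α) (TT _ R)]
  congr 1
  ext s t
  simp [TT, Matrix.sum_apply]

lemma block_eq {k : ℕ} {α : Type} (c : Fin k → Fin k → ℂ)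
    (R : Fin k → Fin k → Matrix α α ℂ) :
    (Matrix.of fun a b : Fin k × α => c a.1 b.1 * R a.1 b.1 a.2 b.2) =
      TT (fun l : Fin k × Fin k => Matrix.single l.1 l.2 (c l.1 l.2)) (fun l => R l.1 l.2) := by
  ext ⟨i, s⟩ ⟨j, t⟩
  rw [TT, Matrix.sum_apply, Finset.sum_eq_single (i, j)]
  · simp
  · rintro ⟨i', j'⟩ _ hne
    simp only [Matrix.kronecker, Matrix.kroneckerMap_apply]
    rw [Matrix.single_apply_of_ne, zero_mul]
    rintro ⟨h1, h2⟩
    exact hne (by rw [← h1, ← h2])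
  · simp

/-- Coherent information of a convex mixture of pure i.i.d. states through `n` copies of a
qubit channel, expressed in terms of the representation-theoretic blocks `σ_r` and `ω_r`:
all the relevant matrices are Hermitian, and
`S(Φₙ(ρ₍ₙ₎)) − S(M) = Σ_r c_r (S(σ_r) − S(ω_r))` with `c_r = q̄_r · m_r`. -/
theorem stmt0 {ι : Type*} [Fintype ι] (K : ι → Matrix (Fin 2) (Fin 2) ℂ)
    (hK : ∑ a, (K a)ᴴ * K a = 1) (n k : ℕ)
    (ψ : Fin k → Fin 2 → ℂ) (hψ : ∀ i, ∑ l, Complex.normSq (ψ i l) = 1)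
    (x : Fin k → ℝ) (hx : ∀ i, 0 < x i) (hxs : ∑ i, x i = 1)
    (σ : Fin k → Fin k → Matrix (Fin 2) (Fin 2) ℂ)
    (hσ : ∀ i j, σ i j = ∑ a, K a * Matrix.vecMulVec (ψ i) (star (ψ j)) * (K a)ᴴ)
    (hpd : ∀ i, (σ i i).PosDef)
    (ρn : Matrix (Fin n → Fin 2) (Fin n → Fin 2) ℂ)
    (hρn : ρn = Matrix.of fun s t =>
      ∑ i, (x i : ℂ) * ∏ l, ψ i (s l) * starRingEnd ℂ (ψ i (t l)))
    (M : Matrix (Fin k × (Fin n → Fin 2)) (Fin k × (Fin n → Fin 2)) ℂ)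
    (hM : M = Matrix.of fun a b => (Real.sqrt (x a.1 * x b.1) : ℂ) *
      prodChannel K n
        (Matrix.of fun s t => ∏ l, ψ a.1 (s l) * starRingEnd ℂ (ψ b.1 (t l))) a.2 b.2)
    (qbar : ℕ → ℂ) (hqbar : ∀ r, qbar r = ∑ i, (x i : ℂ) * (qRep n r (σ i i)).trace)
    (σr : (r : ℕ) → Matrix (Fin (n - 2 * r + 1)) (Fin (n - 2 * r + 1)) ℂ)
    (hσr : ∀ r, σr r = (qbar r)⁻¹ • ∑ i, (x i : ℂ) • qRep n r (σ i i))
    (ωr : (r : ℕ) → Matrix (Fin k × Fin (n - 2 * r + 1)) (Fin k × Fin (n - 2 * r + 1)) ℂ)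
    (hωr : ∀ r, ωr r = Matrix.of fun a b =>
      (Real.sqrt (x a.1 * x b.1) : ℂ) * (qbar r)⁻¹ * qRep n r (σ a.1 b.1) a.2 b.2) :
    (prodChannel K n ρn).IsHermitian ∧ M.IsHermitian ∧
    (∀ r ≤ n / 2, (σr r).IsHermitian) ∧ (∀ r ≤ n / 2, (ωr r).IsHermitian) ∧
    ((vnEntropy (prodChannel K n ρn) - vnEntropy M : ℝ) : ℂ) =
      ∑ r ∈ Finset.range (n / 2 + 1),
        qbar r * (mult n r : ℂ) * ((vnEntropy (σr r) - vnEntropy (ωr r) : ℝ) : ℂ) := by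
  have hk : (Finset.univ : Finset (Fin k)).Nonempty := by
    by_contra h
    rw [Finset.not_nonempty_iff_eq_empty] at h
    rw [h] at hxs
    simp at hxs
  have hσH : ∀ i j, (σ i j)ᴴ = σ j i := by
    intro i j
    rw [hσ, hσ, Matrix.conjTranspose_sum]
    refine Finset.sum_congr rfl fun a _ => ?_
    rw [Matrix.conjTranspose_mul, Matrix.conjTranspose_mul, Matrix.conjTranspose_conjTranspose,
      Matrix.conjTranspose_vecMulVec, star_star, Matrix.mul_assoc]
  have hΦ : prodChannel K n ρn = ∑ i, (x i : ℂ) • tens (fun _ : Fin n => σ i i) := by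
    have : ρn = ∑ i, (x i : ℂ) •
        Matrix.of fun s t => ∏ l, ψ i (s l) * starRingEnd ℂ (ψ i (t l)) := by
      rw [hρn]; ext s t; simp [Matrix.sum_apply]
    rw [this, prodChannel_mix]
    simp only [prodChannel_pure, ← hσ]
  have hM' : M = Matrix.of fun a b => (Real.sqrt (x a.1 * x b.1) : ℂ) *
      tens (fun _ : Fin n => σ a.1 b.1) a.2 b.2 := by
    rw [hM]
    simp only [prodChannel_pure, ← hσ]
  have hq : ∀ r, ∃ t : ℝ, 0 < t ∧ qbar r = t := by
    intro r
    choose t ht e using fun i => trace_qRep_pos (σ i i) (hpd i) n r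
    refine ⟨∑ i, x i * t i, Finset.sum_pos (fun i _ => mul_pos (hx i) (ht i)) hk, ?_⟩
    rw [hqbar]; simp [e]
  choose q hq0 hqe using hq
  have hqC : ∀ r, ((q r : ℝ) : ℂ) ≠ 0 := fun r => Complex.ofReal_ne_zero.mpr (hq0 r).ne'
  have H1 : (prodChannel K n ρn).IsHermitian := by
    rw [hΦ, Matrix.IsHermitian, Matrix.conjTranspose_sum]
    refine Finset.sum_congr rfl fun i _ => ?_
    rw [Matrix.conjTranspose_smul, tens_conjTranspose, hσH]
    simp
  have H2 : M.IsHermitian := by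
    rw [hM']
    ext ⟨i, s⟩ ⟨j, t⟩
    have := congrFun (congrFun (tens_conjTranspose (fun _ : Fin n => σ j i)) s) t
    rw [Matrix.conjTranspose_apply, hσH] at this
    rw [Matrix.conjTranspose_apply]
    simp only [Matrix.of_apply, star_mul']
    rw [this, mul_comm (x j)]
    simp
  have H3 : ∀ r, (σr r).IsHermitian := by
    intro r
    rw [hσr, hqe, Matrix.IsHermitian, Matrix.conjTranspose_smul, Matrix.conjTranspose_sum]
    congr 1
    · simp
    · refine Finset.sum_congr rfl fun i _ => ?_
      rw [Matrix.conjTranspose_smul, qRep_conjTranspose, hσH]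
      simp
  have H4 : ∀ r, (ωr r).IsHermitian := by
    intro r
    rw [hωr, hqe]
    ext ⟨i, s⟩ ⟨j, t⟩
    have := congrFun (congrFun (qRep_conjTranspose n r (σ j i)) s) t
    rw [Matrix.conjTranspose_apply, hσH] at this
    rw [Matrix.conjTranspose_apply]
    simp only [Matrix.of_apply, star_mul']
    rw [this, mul_comm (x j)]
    simp
  have T3 : ∀ r, (σr r).trace = 1 := by
    intro r
    rw [hσr, Matrix.trace_smul, Matrix.trace_sum]
    simp only [Matrix.trace_smul, smul_eq_mul]
    rw [← hqbar, hqe, inv_mul_cancel₀ (hqC r)]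
  have T4 : ∀ r, (ωr r).trace = 1 := by
    intro r
    rw [hωr, Matrix.trace, Fintype.sum_prod_type]
    have : ∀ i, Real.sqrt (x i * x i) = x i := fun i => Real.sqrt_mul_self (hx i).le
    simp only [Matrix.diag_apply, Matrix.of_apply, this]
    have e : ∀ i, ∑ y, (x i : ℂ) * (qbar r)⁻¹ * qRep n r (σ i i) y y =
        (qbar r)⁻¹ * ((x i : ℂ) * (qRep n r (σ i i)).trace) := by
      intro i
      rw [Matrix.trace, Finset.mul_sum, Finset.mul_sum]
      refine Finset.sum_congr rfl fun y _ => ?_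
      rw [Matrix.diag_apply]; ring
    simp only [e]
    rw [← Finset.mul_sum, ← hqbar, hqe, inv_mul_cancel₀ (hqC r)]
  have F1 : FF (prodChannel K n ρn) = ∑ r ∈ Finset.range (n / 2 + 1),
      (mult n r : ℝ) * (q r * FF (σr r) + Real.negMulLog (q r)) := by
    rw [hΦ, FF_mix, TT_main]
    refine Finset.sum_congr rfl fun r _ => ?_
    rw [← FF_mix]
    have : ∑ i, (x i : ℂ) • qRep n r (σ i i) = (q r : ℂ) • σr r := by
      rw [hσr, hqe, smul_smul, mul_inv_cancel₀ (hqC r), one_smul]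
    rw [this, FF_herm _ (H3 r), T3]
    simp
  have F2 : FF M = ∑ r ∈ Finset.range (n / 2 + 1),
      (mult n r : ℝ) * (q r * FF (ωr r) + Real.negMulLog (q r)) := by
    rw [hM', block_eq (fun i j => (Real.sqrt (x i * x j) : ℂ)) (fun i j => tens (fun _ => σ i j)),
      TT_main n _ (fun l : Fin k × Fin k => σ l.1 l.2)]
    refine Finset.sum_congr rfl fun r _ => ?_
    rw [← block_eq (fun i j => (Real.sqrt (x i * x j) : ℂ)) (fun i j => qRep n r (σ i j))]
    have : (Matrix.of fun a b : Fin k × Fin (n - 2 * r + 1) =>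
        (Real.sqrt (x a.1 * x b.1) : ℂ) * qRep n r (σ a.1 b.1) a.2 b.2) = (q r : ℂ) • ωr r := by
      rw [hωr, hqe]
      ext a b
      have := hqC r
      simp only [Matrix.of_apply, Matrix.smul_apply, smul_eq_mul]
      field_simp
    rw [this, FF_herm _ (H4 r), T4]
    simp
  refine ⟨H1, H2, fun r _ => H3 r, fun r _ => H4 r, ?_⟩
  have hfin : vnEntropy (prodChannel K n ρn) - vnEntropy M = ∑ r ∈ Finset.range (n / 2 + 1),
      q r * (mult n r : ℝ) * (vnEntropy (σr r) - vnEntropy (ωr r)) := by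
    rw [vnEntropy_eq _ H1, vnEntropy_eq _ H2, F1, F2, ← mul_sub, ← Finset.sum_sub_distrib,
      Finset.mul_sum]
    refine Finset.sum_congr rfl fun r _ => ?_
    rw [vnEntropy_eq _ (H3 r), vnEntropy_eq _ (H4 r)]
    ring
  rw [hfin]
  push_cast
  simp only [hqe]

end
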